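/- arXiv:2209.02612 — 4 statements merged into one kernel-verified Lean document; each statement's English description precedes it below -/
import Mathlib

section
/- Let β ∈ (0,1) and let λ = {λ_n}_{n≥1} be a non-decreasing sequence of strictly positive real numbers. Define w_n(λ,β) = 1/λ_n + 1/λ_{n+1} − (1/λ_n)(1 − 1/n)^β − (1/λ_{n+1})(1 + 1/n)^β for n ≥ 1 (with (1 − 1/1)^β = 0). Then for every n ≥ 1, w_n(λ,β) > (β(1−β)/2) · (1/n²) · (1/λ_n + 1/λ_{n+1}). -/
lemma aux_deriv (p x : ℝ) (h0 : -1 < x) (h1 : x < 1) :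
    HasDerivAt (fun y : ℝ => (1 - y) ^ p) (-(p * (1 - x) ^ (p - 1))) x ∧
    HasDerivAt (fun y : ℝ => (1 + y) ^ p) (p * (1 + x) ^ (p - 1)) x := by
  constructor
  · have := ((hasDerivAt_id' x).const_sub 1).rpow_const (p := p)
      (Or.inl (by linarith))
    convert this using 1
    ring
  · have := ((hasDerivAt_id' x).const_add 1).rpow_const (p := p)
      (Or.inl (by linarith))
    convert this using 1
    ring

lemma aux_two (p x : ℝ) (hp : p < 0) (h0 : 0 < x) (h1 : x < 1) :
    2 < (1 - x) ^ p + (1 + x) ^ p := by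
  have hu : 0 < (1 - x) ^ p := Real.rpow_pos_of_pos (by linarith) _
  have hv : 0 < (1 + x) ^ p := Real.rpow_pos_of_pos (by linarith) _
  have huv : 1 < (1 - x) ^ p * (1 + x) ^ p := by
    rw [← Real.mul_rpow (by linarith) (by linarith)]
    exact Real.one_lt_rpow_of_pos_of_lt_one_of_neg (by nlinarith) (by nlinarith) hp
  nlinarith [sq_nonneg ((1 - x) ^ p - (1 + x) ^ p)]

lemma aux_first (β x : ℝ) (hb0 : 0 < β) (hb1 : β < 1) (h0 : 0 < x) (h1 : x < 1) :
    0 < (1 - x) ^ (β - 1) - (1 + x) ^ (β - 1) - 2 * (1 - β) * x := by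
  have hd : ∀ y : ℝ, -1 < y → y < 1 → HasDerivAt
      (fun x : ℝ => (1 - x) ^ (β - 1) - (1 + x) ^ (β - 1) - 2 * (1 - β) * x)
      ((1 - β) * ((1 - y) ^ (β - 1 - 1) + (1 + y) ^ (β - 1 - 1) - 2)) y := by
    intro y hy0 hy1
    have h := aux_deriv (β - 1) y hy0 hy1
    refine ((h.1.sub h.2).sub ((hasDerivAt_id' y).const_mul (2 * (1 - β)))).congr_deriv ?_
    ring
  have hm : StrictMonoOn
      (fun x : ℝ => (1 - x) ^ (β - 1) - (1 + x) ^ (β - 1) - 2 * (1 - β) * x)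
      (Set.Icc 0 x) := by
    apply strictMonoOn_of_deriv_pos (convex_Icc _ _)
    · intro y hy
      exact (hd y (by linarith [hy.1]) (by linarith [hy.2])).continuousAt.continuousWithinAt
    · intro y hy
      rw [interior_Icc] at hy
      rw [(hd y (by linarith [hy.1]) (by linarith [hy.2])).deriv]
      have := aux_two (β - 1 - 1) y (by linarith) hy.1 (by linarith [hy.2])
      exact mul_pos (by linarith) (by linarith)
  have := hm (Set.left_mem_Icc.2 h0.le) (Set.right_mem_Icc.2 h0.le) h0
  simpa using this

lemma aux_main (β x : ℝ) (hb0 : 0 < β) (hb1 : β < 1) (h0 : 0 < x) (h1 : x ≤ 1) :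
    0 < 2 - β * (1 - β) * x ^ 2 - (1 - x) ^ β - (1 + x) ^ β := by
  have hm : StrictMonoOn
      (fun x : ℝ => 2 - β * (1 - β) * x ^ 2 - (1 - x) ^ β - (1 + x) ^ β)
      (Set.Icc 0 x) := by
    apply strictMonoOn_of_deriv_pos (convex_Icc _ _)
    · apply Continuous.continuousOn
      have e1 : Continuous (fun x : ℝ => (1 - x) ^ β) :=
        (continuous_const.sub continuous_id).rpow_const (fun _ => Or.inr hb0.le)
      have e2 : Continuous (fun x : ℝ => (1 + x) ^ β) :=
        (continuous_const.add continuous_id).rpow_const (fun _ => Or.inr hb0.le)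
      fun_prop
    · intro y hy
      rw [interior_Icc] at hy
      have hy1 : y < 1 := by linarith [hy.2]
      have h := aux_deriv β y (by linarith [hy.1]) hy1
      have hq := (((hasDerivAt_pow 2 y).const_mul (β * (1 - β))).const_sub 2)
      have hd : HasDerivAt
          (fun x : ℝ => 2 - β * (1 - β) * x ^ 2 - (1 - x) ^ β - (1 + x) ^ β)
          (β * ((1 - y) ^ (β - 1) - (1 + y) ^ (β - 1) - 2 * (1 - β) * y)) y := by
        refine ((hq.sub h.1).sub h.2).congr_deriv ?_
        push_cast
        ring
      rw [hd.deriv]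
      exact mul_pos hb0 (aux_first β y hb0 hb1 hy.1 hy1)
  have := hm (Set.left_mem_Icc.2 h0.le) (Set.right_mem_Icc.2 h0.le) h0
  norm_num at this
  linarith

/-- Remark 2.4: for `β ∈ (0,1)` and a non-decreasing strictly positive sequence
`λ`, the weight `w_n(λ,β) = 1/λ_n + 1/λ_{n+1} - (1/λ_n)(1-1/n)^β - (1/λ_{n+1})(1+1/n)^β`
satisfies `w_n(λ,β) > (β(1-β)/2)(1/n²)(1/λ_n + 1/λ_{n+1})` for every `n ≥ 1`. -/
theorem weight_lower_bound
    (β : ℝ) (hβ : β ∈ Set.Ioo (0 : ℝ) 1)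
    (lam : ℕ → ℝ)
    (hlam : ∀ n : ℕ, 1 ≤ n → 0 < lam n)
    (hmono : ∀ n : ℕ, 1 ≤ n → lam n ≤ lam (n + 1)) :
    ∀ n : ℕ, 1 ≤ n →
      β * (1 - β) / 2 * (1 / (n : ℝ) ^ 2) * (1 / lam n + 1 / lam (n + 1)) <
        1 / lam n + 1 / lam (n + 1)
          - (1 / lam n) * (1 - 1 / (n : ℝ)) ^ β
          - (1 / lam (n + 1)) * (1 + 1 / (n : ℝ)) ^ β := by
  intro n hn
  have hn' : (1 : ℝ) ≤ n := by exact_mod_cast hn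
  have hx0 : 0 < 1 / (n : ℝ) := by positivity
  have hx1 : 1 / (n : ℝ) ≤ 1 := by
    rw [div_le_one (by linarith)]; exact hn'
  have hab : 1 / lam (n + 1) ≤ 1 / lam n := one_div_le_one_div_of_le (hlam n hn) (hmono n hn)
  have hb : 0 < 1 / lam (n + 1) := one_div_pos.2 (hlam _ (by omega))
  have hsq : 1 / (n : ℝ) ^ 2 = (1 / (n : ℝ)) ^ 2 := by rw [div_pow, one_pow]
  rw [hsq]
  generalize 1 / (n : ℝ) = x at *
  generalize 1 / lam n = a at *
  generalize 1 / lam (n + 1) = b at *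
  have hm := aux_main β x hβ.1 hβ.2 hx0 hx1
  have hle : (1 - x) ^ β ≤ (1 + x) ^ β :=
    Real.rpow_le_rpow (by linarith) (by linarith) hβ.1.le
  generalize (1 - x) ^ β = u at *
  generalize (1 + x) ^ β = v at *
  have hA : 0 ≤ 1 - u - β * (1 - β) / 2 * x ^ 2 := by linarith
  have h1 := mul_nonneg (sub_nonneg.2 hab) hA
  have h2 := mul_pos hb hm
  nlinarith
end

section
/- Let S_n = n(n+1)/2 and, for 3/2 ≤ c ≤ 2, define V_n = S_n^{2−c}/n + S_{n+1}^{2−c}/(n+1) − (S_n^{2−c}/n)√(1 − 1/n) − (S_{n+1}^{2−c}/(n+1))√(1 + 1/n). Then for every positive integer n, V_n > ( S_n^{2−c}/n + S_{n+1}^{2−c}/(n+1) ) · 1/(8n²). -/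
/-- Lemma 3.3: with `S_n = n(n+1)/2`, for `3/2 ≤ c ≤ 2` the Copson weight
`V_n = S_n^{2-c}/n + S_{n+1}^{2-c}/(n+1) - (S_n^{2-c}/n)√(1-1/n) - (S_{n+1}^{2-c}/(n+1))√(1+1/n)`
satisfies `V_n > (S_n^{2-c}/n + S_{n+1}^{2-c}/(n+1)) · 1/(8n²)` for every `n ≥ 1`. -/
theorem copson_weight_lower_bound
    (c : ℝ) (hc1 : 3 / 2 ≤ c) (hc2 : c ≤ 2)
    (S : ℕ → ℝ) (hS : ∀ n : ℕ, S n = (n : ℝ) * ((n : ℝ) + 1) / 2)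
    (V : ℕ → ℝ)
    (hV : ∀ n : ℕ, 1 ≤ n →
      V n = S n ^ (2 - c) / (n : ℝ) + S (n + 1) ^ (2 - c) / ((n : ℝ) + 1)
        - S n ^ (2 - c) / (n : ℝ) * Real.sqrt (1 - 1 / (n : ℝ))
        - S (n + 1) ^ (2 - c) / ((n : ℝ) + 1) * Real.sqrt (1 + 1 / (n : ℝ))) :
    ∀ n : ℕ, 1 ≤ n →
      (S n ^ (2 - c) / (n : ℝ) + S (n + 1) ^ (2 - c) / ((n : ℝ) + 1)) * (1 / (8 * (n : ℝ) ^ 2))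
        < V n := by
  intro n hn
  rw [hV n hn]
  have hn1 : (1 : ℝ) ≤ (n : ℝ) := by exact_mod_cast hn
  have hn0 : (0 : ℝ) < (n : ℝ) := by linarith
  have hSn : 0 < S n := by rw [hS]; positivity
  have hr1 : (1 : ℝ) ≤ ((n : ℝ) + 2) / n := by
    rw [le_div_iff₀ hn0]; linarith
  have hSr : S (n + 1) = S n * (((n : ℝ) + 2) / n) := by
    rw [hS, hS]; push_cast; field_simp; ring
  have hrp : (((n : ℝ) + 2) / n) ^ (2 - c) ≤ ((n : ℝ) + 1) / n := by
    calc (((n : ℝ) + 2) / n) ^ (2 - c) ≤ (((n : ℝ) + 2) / n) ^ (1 / 2 : ℝ) :=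
          Real.rpow_le_rpow_of_exponent_le hr1 (by linarith)
      _ = Real.sqrt (((n : ℝ) + 2) / n) := (Real.sqrt_eq_rpow _).symm
      _ ≤ ((n : ℝ) + 1) / n := by
          apply Real.sqrt_le_iff.mpr
          refine ⟨by positivity, ?_⟩
          rw [div_pow, div_le_div_iff₀ hn0 (by positivity)]
          nlinarith
  have hA : 0 < S n ^ (2 - c) / (n : ℝ) := div_pos (Real.rpow_pos_of_pos hSn _) hn0
  have hBA : S (n + 1) ^ (2 - c) / ((n : ℝ) + 1) ≤ S n ^ (2 - c) / (n : ℝ) := by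
    rw [hSr, Real.mul_rpow hSn.le (by linarith), div_le_iff₀ (by linarith)]
    calc S n ^ (2 - c) * (((n : ℝ) + 2) / n) ^ (2 - c)
        ≤ S n ^ (2 - c) * (((n : ℝ) + 1) / n) :=
          mul_le_mul_of_nonneg_left hrp (Real.rpow_pos_of_pos hSn _).le
      _ = S n ^ (2 - c) / (n : ℝ) * ((n : ℝ) + 1) := by ring
  have hx : (1 : ℝ) / (8 * (n : ℝ) ^ 2) = (1 / (n : ℝ)) ^ 2 / 8 := by
    field_simp
  rw [hx]
  have hx0 : 0 < 1 / (n : ℝ) := by positivity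
  have hx1 : 1 / (n : ℝ) ≤ 1 := by rw [div_le_one hn0]; exact hn1
  generalize 1 / (n : ℝ) = x at *
  generalize S n ^ (2 - c) / (n : ℝ) = A at *
  generalize S (n + 1) ^ (2 - c) / ((n : ℝ) + 1) = B at *
  have hu := Real.sq_sqrt (show 0 ≤ 1 - x by linarith)
  have hv := Real.sq_sqrt (show 0 ≤ 1 + x by linarith)
  have hu0 := Real.sqrt_nonneg (1 - x)
  have hv1 : 1 ≤ Real.sqrt (1 + x) := Real.one_le_sqrt.mpr (by linarith)
  generalize Real.sqrt (1 - x) = u at *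
  generalize Real.sqrt (1 + x) = v at *
  have huv : u * v ≤ 1 - x ^ 2 / 2 := by
    refine le_of_abs_le (abs_le_of_sq_le_sq ?_ (by nlinarith))
    rw [mul_pow, hu, hv]
    nlinarith [sq_nonneg (x ^ 2)]
  have hsum : u + v < 2 - x ^ 2 / 4 := by
    apply lt_of_pow_lt_pow_left₀ 2 (by nlinarith)
    have : 0 < x ^ 4 := by positivity
    nlinarith
  have h1 : 0 ≤ (A - B) * (v - 1 + x ^ 2 / 8) :=
    mul_nonneg (by linarith) (by nlinarith [sq_nonneg x])
  have h2 : 0 < A * (2 - x ^ 2 / 4 - (u + v)) := mul_pos hA (by linarith)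
  nlinarith
end

section
/- Let S_n = n(n+1)/2. If 1 < c ≤ 3/2, then for every positive integer n, (1/(8n²)) · ( S_n^{2−c}/n + S_{n+1}^{2−c}/(n+1) ) > ((c−1)²/4) · n / S_n^c. -/
/-- Lemma 3.4: with `S_n = n(n+1)/2`, if `1 < c ≤ 3/2` then for every `n ≥ 1`,
`(1/(8n²))(S_n^{2-c}/n + S_{n+1}^{2-c}/(n+1)) > ((c-1)²/4) · n/S_n^c`. -/
theorem copson_lemma_comparison
    (c : ℝ) (hc1 : 1 < c) (hc2 : c ≤ 3 / 2)
    (S : ℕ → ℝ) (hS : ∀ n : ℕ, S n = (n : ℝ) * ((n : ℝ) + 1) / 2) :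
    ∀ n : ℕ, 1 ≤ n →
      (c - 1) ^ 2 / 4 * ((n : ℝ) / S n ^ c)
        < 1 / (8 * (n : ℝ) ^ 2) * (S n ^ (2 - c) / (n : ℝ) + S (n + 1) ^ (2 - c) / ((n : ℝ) + 1)) := by
  intro n hn
  have hx : (0 : ℝ) < n := by exact_mod_cast hn
  have hpos : 0 < S n := by rw [hS]; positivity
  have hle : S n ≤ S (n + 1) := by
    rw [hS, hS]; push_cast; nlinarith
  have h1 : S n ^ (2 - c) ≤ S (n + 1) ^ (2 - c) :=
    Real.rpow_le_rpow hpos.le hle (by linarith)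
  have h2 : S n ^ (2 - c) = S n ^ 2 / S n ^ c := by
    rw [Real.rpow_sub hpos, Real.rpow_two]
  have hP : 0 < S n ^ c := Real.rpow_pos_of_pos hpos c
  have hsq : (c - 1) ^ 2 ≤ 1 / 4 := by nlinarith
  calc (c - 1) ^ 2 / 4 * ((n : ℝ) / S n ^ c)
      ≤ (1 / 4) / 4 * ((n : ℝ) / S n ^ c) := by gcongr
    _ < 1 / (8 * (n : ℝ) ^ 2) * (S n ^ (2 - c) / (n : ℝ) + S n ^ (2 - c) / ((n : ℝ) + 1)) := by
        rw [h2]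
        have e : 1 / (8 * (n : ℝ) ^ 2) * (S n ^ 2 / S n ^ c / (n : ℝ) + S n ^ 2 / S n ^ c / ((n : ℝ) + 1))
            = ((n + 1) * (2 * n + 1) / (32 * n)) / S n ^ c := by
          generalize S n ^ c = P at hP
          rw [hS]
          field_simp
          ring
        rw [e, ← mul_div_assoc]
        apply div_lt_div_of_pos_right _ hP
        rw [lt_div_iff₀ (by positivity)]
        nlinarith
    _ ≤ _ := by gcongr
end

section
/- Let S_n = n(n+1)/2 and define V_n = √S_n/n + √S_{n+1}/(n+1) − (√S_n/n)√(1 − 1/n) − (√S_{n+1}/(n+1))√(1 + 1/n) (the case c = 3/2 of the weight V_n). Then for every positive integer n, V_n > (1/(8n²)) · ( √S_n/n + √S_{n+1}/(n+1) ) > (1/16) · n / (S_n √S_n). -/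
/-- Lemma 3.5: with `S_n = n(n+1)/2` and the weight (case `c = 3/2`)
`V_n = √S_n/n + √S_{n+1}/(n+1) - (√S_n/n)√(1-1/n) - (√S_{n+1}/(n+1))√(1+1/n)`,
for every `n ≥ 1` one has
`V_n > (1/(8n²))(√S_n/n + √S_{n+1}/(n+1)) > (1/16) · n/(S_n √S_n)`. -/
theorem copson_lemma_final
    (S : ℕ → ℝ) (hS : ∀ n : ℕ, S n = (n : ℝ) * ((n : ℝ) + 1) / 2)
    (V : ℕ → ℝ)
    (hV : ∀ n : ℕ, 1 ≤ n →
      V n = Real.sqrt (S n) / (n : ℝ) + Real.sqrt (S (n + 1)) / ((n : ℝ) + 1)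
        - Real.sqrt (S n) / (n : ℝ) * Real.sqrt (1 - 1 / (n : ℝ))
        - Real.sqrt (S (n + 1)) / ((n : ℝ) + 1) * Real.sqrt (1 + 1 / (n : ℝ))) :
    ∀ n : ℕ, 1 ≤ n →
      1 / (8 * (n : ℝ) ^ 2) * (Real.sqrt (S n) / (n : ℝ) + Real.sqrt (S (n + 1)) / ((n : ℝ) + 1))
          < V n
      ∧ 1 / 16 * ((n : ℝ) / (S n * Real.sqrt (S n)))
          < 1 / (8 * (n : ℝ) ^ 2)
            * (Real.sqrt (S n) / (n : ℝ) + Real.sqrt (S (n + 1)) / ((n : ℝ) + 1)) := by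
  intro n hn
  have hn1 : (1:ℝ) ≤ n := by exact_mod_cast hn
  have hn0 : (0:ℝ) < n := by linarith
  rw [hV n hn]
  obtain ⟨x, hx⟩ : ∃ x : ℝ, x = 1 / (n:ℝ) := ⟨_, rfl⟩
  have hx0 : 0 < x := by rw [hx]; positivity
  have hx1 : x ≤ 1 := by rw [hx, div_le_one hn0]; exact hn1
  have hnx : (n:ℝ) * x = 1 := by rw [hx]; field_simp
  have hSn : 0 < S n := by rw [hS]; positivity
  have hSn1 : 0 < S (n+1) := by rw [hS]; positivity
  obtain ⟨a, ha⟩ : ∃ a : ℝ, a = Real.sqrt (S n) / (n : ℝ) := ⟨_, rfl⟩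
  obtain ⟨b, hb⟩ : ∃ b : ℝ, b = Real.sqrt (S (n+1)) / ((n : ℝ) + 1) := ⟨_, rfl⟩
  have ha0 : 0 < a := by rw [ha]; have := Real.sqrt_pos.2 hSn; positivity
  have hb0 : 0 < b := by rw [hb]; have := Real.sqrt_pos.2 hSn1; positivity
  have ha2 : a ^ 2 = (1 + x) / 2 := by
    rw [ha, div_pow, Real.sq_sqrt hSn.le, hS, hx]; field_simp
  have hb2 : b ^ 2 * (1 + x) = (1 + 2 * x) / 2 := by
    rw [hb, div_pow, Real.sq_sqrt hSn1.le, hS, hx]; push_cast; field_simp; ring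
  have hsq : Real.sqrt (S n) = n * a := by rw [ha]; field_simp
  have hSa : S n = n ^ 2 * a ^ 2 := by rw [← mul_pow, ← hsq, Real.sq_sqrt hSn.le]
  have hab : b < a := by
    apply lt_of_pow_lt_pow_left₀ 2 ha0.le
    rw [ha2]
    have : b ^ 2 * (1 + x) < (1 + x) / 2 * (1 + x) := by rw [hb2]; nlinarith
    exact lt_of_mul_lt_mul_right this (by linarith)
  have hab2 : 1 / 2 < a * b := by
    apply lt_of_pow_lt_pow_left₀ 2 (by positivity)
    have : (a * b) ^ 2 = (1 + 2 * x) / 4 := by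
      rw [mul_pow, ha2]; linarith
    rw [this]; linarith
  have h8 : 1 / (8 * (n:ℝ) ^ 2) = x ^ 2 / 8 := by rw [hx]; field_simp
  rw [h8, ← ha, ← hb, ← hx]
  have h3 : x ^ 3 ≤ 1 := pow_le_one₀ hx0.le hx1
  have h2 : x ^ 2 ≤ 1 := pow_le_one₀ hx0.le hx1
  have p3 : 0 < x ^ 3 := by positivity
  have p4 : 0 < x ^ 4 := by positivity
  have p5 : 0 < x ^ 5 := by positivity
  have p6 : 0 < x ^ 6 := by positivity
  have h54 : x ^ 5 ≤ x ^ 4 := by nlinarith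
  constructor
  · have e1 : Real.sqrt (1 - x) ≤ 1 - x / 2 - x ^ 2 / 8 - x ^ 3 / 16 := by
      apply Real.sqrt_le_iff.2
      constructor
      · linarith
      · nlinarith
    have e2 : Real.sqrt (1 + x) ≤ 1 + x / 2 - x ^ 2 / 8 + x ^ 3 / 16 := by
      apply Real.sqrt_le_iff.2
      constructor
      · linarith
      · nlinarith
    have f1 := mul_le_mul_of_nonneg_left e1 ha0.le
    have f2 := mul_le_mul_of_nonneg_left e2 hb0.le
    have f3 : 0 < (a - b) * (x / 2 + x ^ 3 / 16) := mul_pos (by linarith) (by positivity)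
    nlinarith
  · rw [hsq, hSa]
    have e : 1 / 16 * ((n:ℝ) / (n ^ 2 * a ^ 2 * (n * a))) = x ^ 2 / 8 * (1 / (2 * a ^ 3)) := by
      rw [hx]; field_simp; norm_num
    rw [e]
    apply mul_lt_mul_of_pos_left _ (by positivity)
    rw [div_lt_iff₀ (by positivity)]
    have g : (a + b) * (2 * a ^ 3) = 2 * a ^ 2 * (a ^ 2 + a * b) := by ring
    rw [g, ha2]
    nlinarith
end
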